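/- (Large-scale asymptotics.) Let A ⊆ ℝⁿ be a nonempty compact set. Then W(tA)/tⁿ → vol_n(A) as t → ∞, where tA = { tθ : θ ∈ A } and vol_n denotes n-dimensional Lebesgue measure. In particular, if vol_n(A) > 0, then R*(tA) − n·log t − log vol_n(A/√(2π)) → 0 as t → ∞. -/

import Mathlib

open MeasureTheory ENNReal Real Set Filter
open scoped Pointwise

noncomputable section

/-- The Wills functional `W(A) = ∫_{ℝⁿ} exp(-π·dist(x,A)²) dx ∈ [0,∞]`. -/
def wills (n : ℕ) (A : Set (EuclideanSpace ℝ (Fin n))) : ℝ≥0∞ :=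
  ∫⁻ x, ENNReal.ofReal (Real.exp (-π * (Metric.infDist x A) ^ 2))

/-- The Shtarkov integral `(2π)^{-n/2} ∫ exp(-dist(x,A)²/2) dx`. -/
def shtarkov (n : ℕ) (A : Set (EuclideanSpace ℝ (Fin n))) : ℝ≥0∞ :=
  ∫⁻ x, ENNReal.ofReal ((2 * π) ^ (-(n : ℝ) / 2) * Real.exp (-(Metric.infDist x A) ^ 2 / 2))

/-- The minimax regret `R*(A)`, as a real number (finite for nonempty bounded `A`). -/
def regretReal (n : ℕ) (A : Set (EuclideanSpace ℝ (Fin n))) : ℝ :=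
  Real.log (shtarkov n A).toReal

section GaussianProfile

variable {E : Type*} [NormedAddCommGroup E]

/-- The unnormalised Gaussian profile of a bounded set is dominated by a centred Gaussian. -/
theorem exp_neg_mul_sq_infDist_le {A : Set E} (hA : A.Nonempty) {R c : ℝ} (hc : 0 ≤ c)
    (hR : ∀ a ∈ A, ‖a‖ ≤ R) (x : E) :
    Real.exp (-c * Metric.infDist x A ^ 2) ≤
      Real.exp (c * R ^ 2) * Real.exp (-(c / 2) * ‖x‖ ^ 2) := by
  have hle : ‖x‖ - R ≤ Metric.infDist x A := by
    refine (Metric.le_infDist hA).2 fun a ha => ?_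
    have := norm_sub_norm_le x a
    rw [dist_eq_norm]
    linarith [hR a ha]
  have hR0 : 0 ≤ R := by
    obtain ⟨a, ha⟩ := hA
    exact (norm_nonneg a).trans (hR a ha)
  have hsq : ‖x‖ ^ 2 ≤ 2 * Metric.infDist x A ^ 2 + 2 * R ^ 2 := by
    have h : ‖x‖ ^ 2 ≤ (Metric.infDist x A + R) ^ 2 :=
      pow_le_pow_left₀ (norm_nonneg x) (by linarith) 2
    nlinarith [sq_nonneg (Metric.infDist x A - R)]
  rw [← Real.exp_add, Real.exp_le_exp]
  nlinarith [mul_le_mul_of_nonneg_left hsq hc]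

theorem infDist_smul_smul [NormedSpace ℝ E] {t : ℝ} (ht : 0 < t) (x : E) (A : Set E) :
    Metric.infDist (t • x) (t • A) = t * Metric.infDist x A := by
  rw [infDist_smul₀ ht.ne', Real.norm_of_nonneg ht.le]

theorem continuous_exp_neg_mul_sq_infDist (c : ℝ) (A : Set E) :
    Continuous fun x : E => Real.exp (-c * Metric.infDist x A ^ 2) := by
  have := Metric.continuous_infDist_pt A
  fun_prop

variable [InnerProductSpace ℝ E] [FiniteDimensional ℝ E] [MeasurableSpace E] [BorelSpace E]

theorem integrable_exp_neg_mul_sq_norm {b : ℝ} (hb : 0 < b) :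
    Integrable (fun x : E => Real.exp (-b * ‖x‖ ^ 2)) := by
  have h := (GaussianFourier.integrable_cexp_neg_mul_sq_norm_add (V := E) (b := (b : ℂ))
    (by simpa using hb) 0 0).re
  refine h.congr (ae_of_all _ fun x => ?_)
  have : -(b : ℂ) * (‖x‖ : ℂ) ^ 2 + 0 * (inner ℝ (0 : E) x : ℝ) = ((-b * ‖x‖ ^ 2 : ℝ) : ℂ) := by
    push_cast; ring
  simp only [this]
  exact Complex.exp_ofReal_re _

theorem integral_exp_neg_mul_sq_infDist_smul (c : ℝ) {t : ℝ} (ht : 0 < t) (A : Set E) :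
    (∫ x, Real.exp (-c * Metric.infDist x (t • A) ^ 2)) / t ^ Module.finrank ℝ E =
      ∫ x, Real.exp (-c * (t * Metric.infDist x A) ^ 2) := by
  have h := Measure.integral_comp_smul volume
    (fun x : E => Real.exp (-c * Metric.infDist x (t • A) ^ 2)) t
  simp only [infDist_smul_smul ht] at h
  rw [h, abs_of_pos (by positivity), smul_eq_mul, div_eq_inv_mul]

theorem tendsto_integral_exp_neg_mul_sq_infDist {A : Set E} (hA : A.Nonempty)
    (hAcomp : IsCompact A) {c : ℝ} (hc : 0 < c) :
    Tendsto (fun t : ℝ => ∫ x, Real.exp (-c * (t * Metric.infDist x A) ^ 2)) atTop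
      (nhds (volume A).toReal) := by
  obtain ⟨R, hR⟩ := hAcomp.isBounded.exists_norm_le
  have hvol : ∫ x, A.indicator (fun _ => (1 : ℝ)) x = (volume A).toReal := by
    rw [integral_indicator hAcomp.measurableSet]
    simp [Measure.real]
  rw [← hvol]
  refine tendsto_integral_filter_of_dominated_convergence
    (fun x => Real.exp (c * R ^ 2) * Real.exp (-(c / 2) * ‖x‖ ^ 2)) ?_ ?_
    ((integrable_exp_neg_mul_sq_norm (half_pos hc)).const_mul _) ?_
  · refine Eventually.of_forall fun t => Continuous.aestronglyMeasurable ?_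
    have := Metric.continuous_infDist_pt A
    fun_prop
  · filter_upwards [eventually_ge_atTop 1] with t ht
    refine ae_of_all _ fun x => ?_
    rw [Real.norm_of_nonneg (Real.exp_pos _).le]
    refine le_trans ?_ (exp_neg_mul_sq_infDist_le hA hc.le hR x)
    have h0 : 0 ≤ Metric.infDist x A := Metric.infDist_nonneg
    have h : Metric.infDist x A ^ 2 ≤ (t * Metric.infDist x A) ^ 2 :=
      pow_le_pow_left₀ h0 (le_mul_of_one_le_left h0 ht) 2
    rw [Real.exp_le_exp]
    nlinarith
  · refine ae_of_all _ fun x => ?_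
    by_cases hx : x ∈ A
    · simp [hx, Metric.infDist_zero_of_mem hx]
    · have hpos : 0 < Metric.infDist x A :=
        (hAcomp.isClosed.notMem_iff_infDist_pos hA).1 hx
      rw [indicator_of_notMem hx]
      refine Real.tendsto_exp_atBot.comp ?_
      refine Tendsto.const_mul_atTop_of_neg (neg_lt_zero.2 hc) ?_
      exact (tendsto_pow_atTop two_ne_zero).comp (tendsto_id.atTop_mul_const hpos)

theorem tendsto_integral_exp_neg_mul_sq_infDist_smul {A : Set E} (hA : A.Nonempty)
    (hAcomp : IsCompact A) {c : ℝ} (hc : 0 < c) :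
    Tendsto (fun t : ℝ => (∫ x, Real.exp (-c * Metric.infDist x (t • A) ^ 2)) /
      t ^ Module.finrank ℝ E) atTop (nhds (volume A).toReal) := by
  refine (tendsto_integral_exp_neg_mul_sq_infDist hA hAcomp hc).congr' ?_
  filter_upwards [eventually_gt_atTop 0] with t ht
  exact (integral_exp_neg_mul_sq_infDist_smul c ht A).symm

end GaussianProfile

theorem toReal_wills (n : ℕ) (A : Set (EuclideanSpace ℝ (Fin n))) :
    (wills n A).toReal = ∫ x, Real.exp (-π * Metric.infDist x A ^ 2) :=
  (integral_eq_lintegral_of_nonneg_ae (ae_of_all _ fun _ => (Real.exp_pos _).le)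
    (continuous_exp_neg_mul_sq_infDist π A).aestronglyMeasurable).symm

theorem two_pi_rpow_neg_half (n : ℕ) :
    (2 * π) ^ (-(n : ℝ) / 2) = (√(2 * π))⁻¹ ^ n := by
  rw [Real.sqrt_eq_rpow, ← Real.rpow_neg (by positivity), ← Real.rpow_mul_natCast (by positivity)]
  congr 1
  ring

theorem toReal_shtarkov (n : ℕ) (A : Set (EuclideanSpace ℝ (Fin n))) :
    (shtarkov n A).toReal =
      (√(2 * π))⁻¹ ^ n * ∫ x, Real.exp (-(1 / 2) * Metric.infDist x A ^ 2) := by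
  have hmeas : AEStronglyMeasurable (fun x : EuclideanSpace ℝ (Fin n) =>
      (√(2 * π))⁻¹ ^ n * Real.exp (-(1 / 2) * Metric.infDist x A ^ 2)) volume :=
    ((continuous_exp_neg_mul_sq_infDist (1 / 2) A).const_mul _).aestronglyMeasurable
  rw [← integral_const_mul, integral_eq_lintegral_of_nonneg_ae
    (ae_of_all _ fun _ => by positivity) hmeas, shtarkov, two_pi_rpow_neg_half]
  simp only [neg_div, neg_mul, one_div_mul_eq_div]

/-- Large-scale asymptotics: for a nonempty compact `A ⊆ ℝⁿ`, `W(tA)/tⁿ → vol_n(A)` as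
`t → ∞`; in particular, if `vol_n(A) > 0` then
`R*(tA) - n·log t - log vol_n(A/√(2π)) → 0` as `t → ∞`. -/
theorem wills_large_scale (n : ℕ) (A : Set (EuclideanSpace ℝ (Fin n)))
    (hA : A.Nonempty) (hAcomp : IsCompact A) :
    Tendsto (fun t : ℝ => (wills n (t • A)).toReal / t ^ n) atTop
      (nhds (volume A).toReal) ∧
    (0 < volume A →
      Tendsto (fun t : ℝ =>
          regretReal n (t • A) - n * Real.log t
            - Real.log (volume ((Real.sqrt (2 * π))⁻¹ • A)).toReal)
        atTop (nhds 0)) := by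
  constructor
  · have h := tendsto_integral_exp_neg_mul_sq_infDist_smul hA hAcomp Real.pi_pos
    simpa only [toReal_wills, finrank_euclideanSpace_fin] using h
  · intro hpos
    have hs : 0 < (√(2 * π))⁻¹ ^ n := by positivity
    have hvol : 0 < (volume A).toReal := ENNReal.toReal_pos hpos.ne' hAcomp.measure_lt_top.ne
    have h := tendsto_integral_exp_neg_mul_sq_infDist_smul hA hAcomp (c := 1 / 2) (by norm_num)
    rw [finrank_euclideanSpace_fin] at h
    have hscale : (volume ((√(2 * π))⁻¹ • A)).toReal =
        (√(2 * π))⁻¹ ^ n * (volume A).toReal := by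
      rw [Measure.addHaar_smul, finrank_euclideanSpace_fin, abs_of_pos hs, ENNReal.toReal_mul,
        ENNReal.toReal_ofReal hs.le]
    rw [hscale]
    have hlog := ((h.const_mul ((√(2 * π))⁻¹ ^ n)).log (mul_pos hs hvol).ne').sub_const
      (Real.log ((√(2 * π))⁻¹ ^ n * (volume A).toReal))
    rw [sub_self] at hlog
    refine hlog.congr' ?_
    filter_upwards [eventually_gt_atTop 0, h.eventually (lt_mem_nhds hvol)] with t ht hI
    have htn : 0 < t ^ n := pow_pos ht n
    have hI' := (div_pos_iff_of_pos_right htn).1 hI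
    rw [regretReal, toReal_shtarkov, ← mul_div_assoc,
      Real.log_div (mul_pos hs hI').ne' htn.ne', Real.log_pow]
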